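/- arXiv:1502.00360 — 2 statements merged into one kernel-verified Lean document; each statement's English description precedes it below -/
import Mathlib

section
/- If G is a finite nilpotent group, then MaxDim(G) = m(G). -/
/-- A sequence of group elements is irredundant if no element lies in the
subgroup generated by the others. -/
def Irredundant {G : Type*} [Group G] {n : ℕ} (g : Fin n → G) : Prop :=
  ∀ i, g i ∉ Subgroup.closure (g '' {j | j ≠ i})

/-- A sequence of group elements generates the group. -/
def Generates {G : Type*} [Group G] {n : ℕ} (g : Fin n → G) : Prop :=
  Subgroup.closure (Set.range g) = ⊤

/-- A family of subgroups is in general position if removing any one member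
strictly enlarges the intersection. -/
def InGeneralPosition {G : Type*} [Group G] {n : ℕ} (H : Fin n → Subgroup G) : Prop :=
  ∀ i, (⨅ j, H j) < ⨅ j ∈ {j | j ≠ i}, H j

/-- `mG G` is the maximum length of an irredundant generating sequence of `G`. -/
noncomputable def mG (G : Type*) [Group G] : ℕ :=
  sSup {n | ∃ g : Fin n → G, Irredundant g ∧ Generates g}

/-- `iG G` is the maximum length of an irredundant sequence in `G`. -/
noncomputable def iG (G : Type*) [Group G] : ℕ :=
  sSup {n | ∃ g : Fin n → G, Irredundant g}

/-- `MaxDim G` is the maximum size of a family of maximal subgroups of `G`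
in general position. -/
noncomputable def MaxDim (G : Type*) [Group G] : ℕ :=
  sSup {n | ∃ M : Fin n → Subgroup G, (∀ i, IsCoatom (M i)) ∧ InGeneralPosition M}

theorem inGeneralPosition_iff {G : Type*} [Group G] {n : ℕ} {M : Fin n → Subgroup G} :
    InGeneralPosition M ↔ ∀ i, ∃ x, x ∉ M i ∧ ∀ j, j ≠ i → x ∈ M j := by
  refine forall_congr' fun i => ?_
  have hle : (⨅ j, M j) ≤ ⨅ j ∈ {j | j ≠ i}, M j := le_iInf₂ fun j _ => iInf_le M j
  rw [lt_iff_le_not_ge, and_iff_right hle, SetLike.not_le_iff_exists]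
  simp only [Subgroup.mem_iInf, Set.mem_ofPred_eq]
  refine exists_congr fun x => ⟨fun ⟨h₁, h₂⟩ => ⟨fun hx => h₂ fun j => ?_, h₁⟩,
    fun ⟨h₁, h₂⟩ => ⟨h₂, fun h => h₁ (h i)⟩⟩
  by_cases hj : j = i
  · exact hj ▸ hx
  · exact h₁ j hj

theorem InGeneralPosition.injective {G : Type*} [Group G] {n : ℕ} {M : Fin n → Subgroup G}
    (hM : InGeneralPosition M) : Function.Injective M := by
  intro i j hij
  by_contra hne
  obtain ⟨x, hx, hx'⟩ := inGeneralPosition_iff.1 hM i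
  exact hx (hij ▸ hx' j (Ne.symm hne))

theorem bddAbove_card_inGeneralPosition (G : Type*) [Group G] [Finite G] :
    BddAbove {n | ∃ M : Fin n → Subgroup G, (∀ i, IsCoatom (M i)) ∧ InGeneralPosition M} := by
  refine ⟨Nat.card (Subgroup G), ?_⟩
  rintro n ⟨M, -, hM⟩
  simpa using Nat.card_le_card_of_injective M hM.injective

/-- An irredundant generating sequence yields maximal subgroups in general position. -/
theorem exists_isCoatom_inGeneralPosition {G : Type*} [Group G] [Finite G] {n : ℕ}
    {g : Fin n → G} (hg : Irredundant g) (hgen : Generates g) :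
    ∃ M : Fin n → Subgroup G, (∀ i, IsCoatom (M i)) ∧ InGeneralPosition M := by
  have key : ∀ i, ∃ K : Subgroup G, IsCoatom K ∧
      Subgroup.closure (g '' {j | j ≠ i}) ≤ K := fun i =>
    (eq_top_or_exists_le_coatom _).resolve_left fun h => hg i (h ▸ Subgroup.mem_top _)
  choose M hM hle using key
  have hmem : ∀ i j, j ≠ i → g j ∈ M i := fun i j hji =>
    hle i (Subgroup.subset_closure ⟨j, hji, rfl⟩)
  refine ⟨M, hM, inGeneralPosition_iff.2 fun i =>
    ⟨g i, fun hi => (hM i).1 ?_, fun j hj => hmem j i hj.symm⟩⟩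
  rw [eq_top_iff, ← (hgen : Subgroup.closure (Set.range g) = ⊤), Subgroup.closure_le]
  rintro _ ⟨j, rfl⟩
  by_cases hj : j = i
  · exact hj ▸ hi
  · exact hmem i j hj

/-- Elements dual to finitely many normal maximal subgroups generate the group modulo the
intersection of these subgroups. -/
theorem closure_range_sup_iInf_eq_top {G ι : Type*} [Group G] [Finite ι] {M : ι → Subgroup G}
    (hM : ∀ i, IsCoatom (M i)) (hN : ∀ i, (M i).Normal) {g : ι → G} (hg : ∀ i, g i ∉ M i)
    (hg' : ∀ i j, j ≠ i → g i ∈ M j) :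
    Subgroup.closure (Set.range g) ⊔ ⨅ i, M i = ⊤ := by
  classical
  have := Fintype.ofFinite ι
  have key : ∀ T : Finset ι, ∀ x : G,
      ∃ h ∈ Subgroup.closure (Set.range g), ∀ i ∈ T, h⁻¹ * x ∈ M i := by
    intro T x
    induction T using Finset.induction_on with
    | empty => exact ⟨1, one_mem _, by simp⟩
    | insert i T hi ih =>
      obtain ⟨h, hh, hT⟩ := ih
      have := hN i
      have htop : Subgroup.zpowers (g i) ⊔ M i = ⊤ :=
        (hM i).2 _ (right_lt_sup.2 fun hle => hg i (hle (Subgroup.mem_zpowers _)))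
      have hx : h⁻¹ * x ∈ Subgroup.zpowers (g i) ⊔ M i := htop ▸ Subgroup.mem_top _
      obtain ⟨y, hy, z, hz, hyz⟩ := Subgroup.mem_sup_of_normal_right.1 hx
      have hz' : (h * y)⁻¹ * x = z := by
        rw [mul_inv_rev, mul_assoc, ← hyz, inv_mul_cancel_left]
      refine ⟨h * y, mul_mem hh ?_, fun j hj => ?_⟩
      · exact Subgroup.zpowers_le.2 (Subgroup.subset_closure (Set.mem_range_self i)) hy
      · rw [hz']
        rcases Finset.mem_insert.1 hj with rfl | hj
        · exact hz
        · have hji : j ≠ i := fun h => hi (h ▸ hj)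
          have hy' : y ∈ M j := Subgroup.zpowers_le.2 (hg' i j hji) hy
          exact ((M j).mul_mem_cancel_left hy').1 (hyz ▸ hT j hj)
  rw [eq_top_iff]
  intro x _
  obtain ⟨h, hh, hx⟩ := key Finset.univ x
  rw [← mul_inv_cancel_left h x]
  exact Subgroup.mul_mem_sup hh (Subgroup.mem_iInf.2 fun i => hx i (Finset.mem_univ i))

theorem exists_irredundant_generates_of_set {G : Type*} [Group G] {A : Set G} (hfin : A.Finite)
    (hA : ∀ a ∈ A, a ∉ Subgroup.closure (A \ {a})) (hgen : Subgroup.closure A = ⊤) :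
    ∃ g : Fin A.ncard → G, Irredundant g ∧ Generates g := by
  have := hfin.to_subtype
  let e : Fin A.ncard ≃ A := (Finite.equivFinOfCardEq (Nat.card_coe_set_eq A)).symm
  refine ⟨fun i => e i, fun i hi => hA _ (e i).2 (Subgroup.closure_mono ?_ hi), ?_⟩
  · rintro _ ⟨j, hj, rfl⟩
    exact ⟨(e j).2, fun h => hj (e.injective (Subtype.ext h))⟩
  · have hrange : Set.range (fun i => (e i : G)) = A := by
      rw [← Function.comp_def, e.surjective.range_comp, Subtype.range_coe]
    rw [Generates, hrange, hgen]

/-- Normal maximal subgroups in general position yield an irredundant generating sequence which is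
at least as long. -/
theorem exists_le_irredundant_generates {G : Type*} [Group G] [Finite G] {n : ℕ}
    {M : Fin n → Subgroup G} (hM : ∀ i, IsCoatom (M i)) (hN : ∀ i, (M i).Normal)
    (hpos : InGeneralPosition M) :
    ∃ m, n ≤ m ∧ ∃ g : Fin m → G, Irredundant g ∧ Generates g := by
  choose g hg hg' using inGeneralPosition_iff.1 hpos
  have htop := closure_range_sup_iInf_eq_top hM hN hg hg'
  have hne : {A : Set G | Set.range g ⊆ A ∧ A ⊆ Set.range g ∪ ((⨅ i, M i : Subgroup G) : Set G) ∧
      Subgroup.closure A = ⊤}.Nonempty :=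
    ⟨_, Set.subset_union_left, subset_rfl, by
      rw [Subgroup.closure_union, Subgroup.closure_eq, htop]⟩
  obtain ⟨A, ⟨hgA, hAg, hAtop⟩, hmin⟩ := (Set.toFinite _).exists_minimal hne
  refine ⟨A.ncard, ?_, exists_irredundant_generates_of_set A.toFinite (fun a ha hmem => ?_) hAtop⟩
  · have hinj : Function.Injective g := fun i j hij => by
      by_contra hne
      exact hg i (hij ▸ hg' j i hne)
    have hcard : (Set.range g).ncard = n := by
      rw [← Nat.card_coe_set_eq, Nat.card_range_of_injective hinj, Nat.card_fin]
    exact hcard ▸ Set.ncard_le_ncard hgA A.toFinite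
  · by_cases har : a ∈ Set.range g
    · obtain ⟨i, rfl⟩ := har
      refine hg i ((Subgroup.closure_le (M i)).2 ?_ hmem)
      rintro x ⟨hxA, hxi⟩
      rcases hAg hxA with ⟨j, rfl⟩ | hx
      · exact hg' j i fun h => hxi (h ▸ rfl)
      · exact iInf_le M i hx
    · have hsub : A ⊆ Subgroup.closure (A \ {a}) := fun x hx => by
        by_cases hxa : x = a
        · exact hxa ▸ hmem
        · exact Subgroup.subset_closure ⟨hx, hxa⟩
      have hle : A ⊆ A \ {a} := hmin
        ⟨fun x hx => ⟨hgA hx, fun h => har (h ▸ hx)⟩, Set.sdiff_subset.trans hAg,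
          top_le_iff.1 (hAtop ▸ (Subgroup.closure_le _).2 hsub)⟩ Set.sdiff_subset
      exact (hle ha).2 rfl

/-- If `G` is a finite nilpotent group, then `MaxDim(G) = m(G)`. -/
theorem MaxDim_eq_mG_of_nilpotent (G : Type*) [Group G] [Finite G]
    [Group.IsNilpotent G] : MaxDim G = mG G := by
  have hsub : {n | ∃ g : Fin n → G, Irredundant g ∧ Generates g} ⊆
      {n | ∃ M : Fin n → Subgroup G, (∀ i, IsCoatom (M i)) ∧ InGeneralPosition M} :=
    fun n ⟨_, hg, hgen⟩ => exists_isCoatom_inGeneralPosition hg hgen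
  have hbdd := bddAbove_card_inGeneralPosition G
  refine le_antisymm (csSup_le' ?_) (csSup_le_csSup' hbdd hsub)
  rintro n ⟨M, hM, hpos⟩
  have hN : ∀ i, (M i).Normal := fun i =>
    Subgroup.NormalizerCondition.normal_of_coatom _ Group.normalizerCondition_of_isNilpotent (hM i)
  obtain ⟨m, hnm, hm⟩ := exists_le_irredundant_generates hM hN hpos
  exact hnm.trans (le_csSup (hbdd.mono hsub) hm)
end

section
/- Let G be a finite supersolvable group, let p be the largest prime dividing |G|, let P be the normal Sylow p-subgroup of G, and let K be a complement to P, so G = P ⋊ K. Then m(G) = m(P) + m(K). -/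
/-- For subgroups `A B ≤ G` with `A` normal in `G`, the quotient `B / (A ∩ B)`
(that is, `B/A` when `A ≤ B`) is cyclic. -/
def CyclicQuot {G : Type*} [Group G] (A B : Subgroup G) (hA : A.Normal) : Prop := by
  letI : (A.subgroupOf B).Normal := hA.subgroupOf B
  exact IsCyclic (B ⧸ A.subgroupOf B)

/-- For subgroups `A ≤ B ≤ G` with `A` normal in `G`, the quotient `B/A`
is cyclic of prime order. -/
def PrimeCyclicQuot {G : Type*} [Group G] (A B : Subgroup G) (hA : A.Normal) : Prop := by
  letI : (A.subgroupOf B).Normal := hA.subgroupOf B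
  exact IsCyclic (B ⧸ A.subgroupOf B) ∧ (Nat.card (B ⧸ A.subgroupOf B)).Prime

/-- A group `G` is supersolvable if it has a chain
`1 = G₀ ≤ G₁ ≤ ⋯ ≤ Gₙ = G` of subgroups, each normal in `G`, with each
successive quotient `G_{i+1}/G_i` cyclic. -/
def Supersolvable (G : Type*) [Group G] : Prop :=
  ∃ (n : ℕ) (H : Fin (n + 1) → Subgroup G) (hnorm : ∀ i, (H i).Normal),
    H 0 = ⊥ ∧ H (Fin.last n) = ⊤ ∧
    (∀ i : Fin n, H i.castSucc ≤ H i.succ) ∧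
    ∀ i : Fin n, CyclicQuot (H i.castSucc) (H i.succ) (hnorm i.castSucc)

/-- `s` is a minimal set generating `G` together with the subgroup `N`. -/
def IsMinGenMod {G : Type*} [Group G] (N : Subgroup G) (s : Set G) : Prop :=
  Minimal (fun t : Set G => Subgroup.closure t ⊔ N = ⊤) s

/-- The maximum size of a minimal set generating `G` together with `N`. -/
noncomputable def mGMod {G : Type*} [Group G] (N : Subgroup G) : ℕ :=
  sSup {n | ∃ s : Set G, IsMinGenMod N s ∧ s.ncard = n}

namespace Minimal

variable {α β : Type*} {p : Set α → Prop} {q : Set β → Prop} {f : α → β} {s : Set α}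

lemma injOn_of_image (hs : Minimal p s) (h : ∀ t ⊆ s, q (f '' t) → p t) (hq : q (f '' s)) :
    Set.InjOn f s := by
  intro x hx y hy hxy
  by_contra hne
  have himg : f '' (s \ {y}) = f '' s := by
    refine (Set.image_mono Set.sdiff_subset).antisymm ?_
    rintro _ ⟨z, hz, rfl⟩
    by_cases hzy : z = y
    · exact ⟨x, ⟨hx, hne⟩, by rw [hxy, hzy]⟩
    · exact ⟨z, ⟨hz, hzy⟩, rfl⟩
  have := hs.2 (h _ Set.sdiff_subset (himg ▸ hq)) Set.sdiff_subset hy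
  exact this.2 rfl

lemma set_image (hs : Minimal p s) (h : ∀ t ⊆ s, q (f '' t) → p t) (hq : q (f '' s)) :
    Minimal q (f '' s) := by
  refine ⟨hq, fun u hu hus => ?_⟩
  have hu' : f '' (s ∩ f ⁻¹' u) = u := by
    rw [Set.image_inter_preimage, Set.inter_eq_right.2 hus]
  have := hs.2 (h _ Set.inter_subset_left (hu'.symm ▸ hu)) Set.inter_subset_left
  rintro _ ⟨x, hx, rfl⟩
  exact (this hx).2

end Minimal

lemma image_ne_eq_range_diff {ι α : Type*} {g : ι → α} (hg : Function.Injective g) (i : ι) :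
    g '' {j | j ≠ i} = Set.range g \ {g i} := by
  ext x
  constructor
  · rintro ⟨j, hj, rfl⟩
    exact ⟨⟨j, rfl⟩, fun h => hj (hg h)⟩
  · rintro ⟨⟨j, rfl⟩, hj⟩
    exact ⟨j, fun h => hj (h ▸ rfl), rfl⟩

section MinGenMod

variable {G : Type*} [Group G]

lemma IsMinGenMod.notMem_closure_diff {N : Subgroup G} {s : Set G} (hs : IsMinGenMod N s) {x : G}
    (hx : x ∈ s) : x ∉ Subgroup.closure (s \ {x}) := by
  intro hmem
  have hle : Subgroup.closure s ≤ Subgroup.closure (s \ {x}) := by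
    rw [Subgroup.closure_le]
    intro y hy
    by_cases hyx : y = x
    · exact hyx ▸ hmem
    · exact Subgroup.subset_closure ⟨hy, hyx⟩
  have htop : Subgroup.closure (s \ {x}) ⊔ N = ⊤ := top_le_iff.1 (hs.1 ▸ sup_le_sup_right hle N)
  exact (hs.2 htop Set.sdiff_subset hx).2 rfl

lemma isMinGenMod_bot_iff {s : Set G} :
    IsMinGenMod ⊥ s ↔
      Subgroup.closure s = ⊤ ∧ ∀ x ∈ s, x ∉ Subgroup.closure (s \ {x}) := by
  refine ⟨fun h => ⟨by simpa using h.1, fun x hx => h.notMem_closure_diff hx⟩, ?_⟩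
  rintro ⟨h, hx⟩
  refine ⟨by simpa using h, fun t ht hts x hxs => ?_⟩
  by_contra hxt
  apply hx x hxs
  have hle : Subgroup.closure t ≤ Subgroup.closure (s \ {x}) :=
    Subgroup.closure_mono fun y hy => ⟨hts hy, fun h => hxt (h ▸ hy)⟩
  have ht' : Subgroup.closure t = ⊤ := (sup_bot_eq _).symm.trans ht
  exact hle (ht' ▸ Subgroup.mem_top x)

lemma Irredundant.injective {n : ℕ} {g : Fin n → G} (hg : Irredundant g) :
    Function.Injective g := by
  intro i j hij
  by_contra hne
  exact hg i (Subgroup.subset_closure ⟨j, fun h => hne h.symm, hij.symm⟩)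

lemma mG_eq_mGMod_bot [Finite G] : mG G = mGMod (⊥ : Subgroup G) := by
  unfold mG mGMod
  congr 1
  ext n
  constructor
  · rintro ⟨g, hirr, hgen⟩
    refine ⟨Set.range g, isMinGenMod_bot_iff.2 ⟨hgen, ?_⟩, ?_⟩
    · rintro _ ⟨i, rfl⟩
      rw [← image_ne_eq_range_diff hirr.injective]
      exact hirr i
    · rw [← Set.image_univ, Set.ncard_image_of_injective _ hirr.injective, Set.ncard_univ,
        Nat.card_eq_fintype_card, Fintype.card_fin]
  · rintro ⟨s, hs, hn⟩
    have hfin : Finite s := inferInstance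
    rw [isMinGenMod_bot_iff] at hs
    have e : Fin n ≃ s := (Finite.equivFinOfCardEq (by rw [Nat.card_coe_set_eq, hn])).symm
    have hinj : Function.Injective fun i => (e i : G) := Subtype.val_injective.comp e.injective
    have hrange : Set.range (fun i => (e i : G)) = s := by
      rw [Set.range_comp' Subtype.val e, e.range_eq_univ, Set.image_univ, Subtype.range_coe]
    refine ⟨fun i => e i, fun i => ?_, ?_⟩
    · rw [image_ne_eq_range_diff hinj, hrange]
      exact hs.2 _ (e i).2
    · rw [Generates, hrange]
      exact hs.1

variable [Finite G]

lemma IsMinGenMod.ncard_le {N : Subgroup G} {s : Set G} (hs : IsMinGenMod N s) :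
    s.ncard ≤ mGMod N := by
  refine le_csSup ⟨Nat.card G, ?_⟩ ⟨s, hs, rfl⟩
  rintro _ ⟨t, -, rfl⟩
  exact Set.ncard_le_card t

lemma exists_isMinGenMod_subset {N : Subgroup G} {s : Set G}
    (hs : Subgroup.closure s ⊔ N = ⊤) : ∃ t ⊆ s, IsMinGenMod N t :=
  exists_minimal_le_of_wellFoundedLT (fun t : Set G => Subgroup.closure t ⊔ N = ⊤) s hs

lemma exists_isMinGenMod_ncard_eq (N : Subgroup G) :
    ∃ s : Set G, IsMinGenMod N s ∧ s.ncard = mGMod N := by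
  obtain ⟨t, -, ht⟩ := exists_isMinGenMod_subset (N := N) (s := Set.univ) (by simp)
  refine Nat.sSup_mem (s := {n | ∃ s : Set G, IsMinGenMod N s ∧ s.ncard = n}) ⟨_, t, ht, rfl⟩
    ⟨Nat.card G, ?_⟩
  rintro _ ⟨t, -, rfl⟩
  exact Set.ncard_le_card t

lemma mGMod_le_iff {N : Subgroup G} {n : ℕ} :
    mGMod N ≤ n ↔ ∀ s, IsMinGenMod N s → s.ncard ≤ n := by
  refine ⟨fun h s hs => hs.ncard_le.trans h, fun h => ?_⟩
  obtain ⟨s, hs, hn⟩ := exists_isMinGenMod_ncard_eq N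
  exact hn ▸ h s hs

lemma mGMod_top : mGMod (⊤ : Subgroup G) = 0 := by
  refine Nat.le_zero.1 (mGMod_le_iff.2 fun s hs => ?_)
  have : s ⊆ ∅ := hs.2 (by simp) (Set.empty_subset s)
  simp [Set.subset_empty_iff.1 this]

lemma mGMod_ker {H : Type*} [Group H] [Finite H] (f : G →* H) (hf : Function.Surjective f) :
    mGMod f.ker = mGMod (⊥ : Subgroup H) := by
  have key : ∀ t : Set G, Subgroup.closure (f '' t) ⊔ ⊥ = ⊤ ↔ Subgroup.closure t ⊔ f.ker = ⊤ := by
    intro t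
    rw [sup_bot_eq, ← MonoidHom.map_closure, ← Subgroup.comap_map_eq]
    refine ⟨fun h => by rw [h, Subgroup.comap_top], fun h => ?_⟩
    exact Subgroup.comap_injective hf (by rw [h, Subgroup.comap_top])
  apply le_antisymm
  · refine mGMod_le_iff.2 fun s hs => ?_
    have hq := (key s).2 hs.1
    have hinj := Minimal.injOn_of_image (q := fun t => Subgroup.closure t ⊔ ⊥ = ⊤) hs
      (fun t _ => (key t).1) hq
    rw [← hinj.ncard_image]
    exact IsMinGenMod.ncard_le (Minimal.set_image hs (fun t _ => (key t).1) hq)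
  · refine mGMod_le_iff.2 fun s hs => ?_
    obtain ⟨σ, hσ⟩ := hf.hasRightInverse
    have key' : ∀ t : Set H,
        Subgroup.closure (σ '' t) ⊔ f.ker = ⊤ ↔ Subgroup.closure t ⊔ ⊥ = ⊤ := by
      intro t
      rw [← key, Set.image_image]
      simp only [hσ _, Set.image_id']
    have hq := (key' s).2 hs.1
    rw [← Set.ncard_image_of_injective s hσ.injective]
    exact IsMinGenMod.ncard_le (Minimal.set_image hs (fun t _ => (key' t).1) hq)

lemma mGMod_eq_mG_of_isComplement' {N K : Subgroup G} [N.Normal]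
    (h : Subgroup.IsComplement' N K) : mGMod N = mG K := by
  let f : G →* K := (h.symm.QuotientMulEquiv : G ⧸ N →* K).comp (QuotientGroup.mk' N)
  have hker : f.ker = N := by
    rw [MonoidHom.ker_mulEquiv_comp, QuotientGroup.ker_mk']
  rw [mG_eq_mGMod_bot, ← mGMod_ker f (h.symm.QuotientMulEquiv.surjective.comp
    (QuotientGroup.mk'_surjective N)), hker]

lemma mGMod_eq_mG_of_nongenerating {N : Subgroup G} (h : ∀ H : Subgroup G, H ⊔ N = ⊤ → H = ⊤) :
    mGMod N = mG G := by
  rw [mG_eq_mGMod_bot]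
  have : ∀ s : Set G, Subgroup.closure s ⊔ N = ⊤ ↔ Subgroup.closure s ⊔ ⊥ = ⊤ := fun s =>
    ⟨fun hs => by rw [h _ hs, top_sup_eq], fun hs => by rw [sup_bot_eq] at hs; rw [hs, top_sup_eq]⟩
  simp only [mGMod, IsMinGenMod, this]

end MinGenMod

namespace Subgroup

variable {G : Type*} [Group G]

/-- Dedekind's modular law. -/
lemma sup_inf_le_sup_inf_of_normal {L M T : Subgroup G} [M.Normal] (h : L ≤ T) :
    (L ⊔ M) ⊓ T ≤ L ⊔ M ⊓ T := by
  rintro x ⟨hx, hxT⟩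
  obtain ⟨l, hl, m, hm, rfl⟩ := mem_sup_of_normal_right.1 hx
  exact mul_mem_sup hl ⟨hm, (T.mul_mem_cancel_left (h hl)).1 hxT⟩

lemma isCoatom_of_covBy_of_sup_eq_top {N M L : Subgroup G} [M.Normal] (hNM : N ⋖ M)
    (hNL : N ≤ L) (hLM : L ⊔ M = ⊤) (hL : L ≠ ⊤) : IsCoatom L := by
  refine ⟨hL, fun T hT => ?_⟩
  have hTL : T ≤ L ⊔ M ⊓ T := by
    simpa [hLM] using sup_inf_le_sup_inf_of_normal (M := M) hT.le
  rcases hNM.eq_or_eq (le_inf hNM.le (hNL.trans hT.le)) inf_le_left with h | h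
  · rw [h, sup_eq_left.2 hNL] at hTL
    exact absurd hTL hT.not_ge
  · exact top_le_iff.1 (hLM ▸ sup_le hT.le (h ▸ inf_le_right))

end Subgroup

section Step

variable {G : Type*} [Group G] [Finite G] {N M L : Subgroup G} [M.Normal]

lemma mGMod_le_add_one (hNM : N ⋖ M) : mGMod N ≤ mGMod M + 1 := by
  refine mGMod_le_iff.2 fun s hs => ?_
  obtain ⟨t, hts, ht⟩ := exists_isMinGenMod_subset (N := M) (s := s)
    (top_le_iff.1 (hs.1 ▸ sup_le_sup_left hNM.le _))
  by_cases htop : Subgroup.closure t ⊔ N = ⊤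
  · rw [hts.antisymm (hs.2 htop hts)] at ht
    exact ht.ncard_le.trans (Nat.le_succ _)
  have hco := Subgroup.isCoatom_of_covBy_of_sup_eq_top hNM le_sup_right
    (by rw [sup_assoc, sup_eq_right.2 hNM.le]; exact ht.1) htop
  obtain ⟨x, hxs, hx⟩ : ∃ x ∈ s, x ∉ Subgroup.closure t ⊔ N := by
    by_contra! hall
    exact htop (top_le_iff.1 (hs.1 ▸ sup_le ((Subgroup.closure_le _).2 hall) le_sup_right))
  have hlt : Subgroup.closure t ⊔ N < Subgroup.closure (insert x t) ⊔ N := by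
    refine lt_of_le_of_ne (sup_le_sup_right (Subgroup.closure_mono (Set.subset_insert x t)) N) ?_
    intro h
    exact hx (h ▸ Subgroup.mem_sup_left (Subgroup.subset_closure (Set.mem_insert x t)))
  have hsub := hs.2 (hco.2 _ hlt) (Set.insert_subset hxs hts)
  calc s.ncard ≤ (insert x t).ncard := Set.ncard_le_ncard hsub
    _ ≤ t.ncard + 1 := Set.ncard_insert_le x t
    _ ≤ mGMod M + 1 := Nat.add_le_add_right ht.ncard_le 1

lemma add_one_le_mGMod (hNM : N ⋖ M) (hNL : N ≤ L) (hLM : L ⊔ M = ⊤) (hL : L ≠ ⊤) :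
    mGMod M + 1 ≤ mGMod N := by
  obtain ⟨s, hs, hcard⟩ := exists_isMinGenMod_ncard_eq M
  have hdecomp : ∀ x : G, ∃ l ∈ L, x⁻¹ * l ∈ M := by
    intro x
    obtain ⟨l, hl, m, hm, rfl⟩ : ∃ l ∈ L, ∃ m ∈ M, l * m = x :=
      Subgroup.mem_sup_of_normal_right.1 (hLM ▸ Subgroup.mem_top x)
    exact ⟨l, hl, by simpa using M.inv_mem hm⟩
  choose l hlL hlM using hdecomp
  have hcl : ∀ t : Set G, Subgroup.closure (l '' t) ⊔ M = Subgroup.closure t ⊔ M := by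
    intro t
    apply le_antisymm
    · refine sup_le ((Subgroup.closure_le _).2 ?_) le_sup_right
      rintro _ ⟨x, hx, rfl⟩
      simpa using Subgroup.mul_mem_sup (Subgroup.subset_closure hx) (hlM x)
    · refine sup_le ((Subgroup.closure_le _).2 fun x hx => ?_) le_sup_right
      simpa using Subgroup.mul_mem_sup (Subgroup.subset_closure (Set.mem_image_of_mem l hx))
        (M.inv_mem (hlM x))
  have hq : Subgroup.closure (l '' s) ⊔ M = ⊤ := (hcl s).trans hs.1
  have hinj := Minimal.injOn_of_image (q := fun t => Subgroup.closure t ⊔ M = ⊤) hs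
    (fun t _ h => (hcl t).symm.trans h) hq
  have hmin : IsMinGenMod M (l '' s) :=
    Minimal.set_image hs (fun t _ h => (hcl t).symm.trans h) hq
  have hlsL : Subgroup.closure (l '' s) ≤ L := by
    rw [Subgroup.closure_le]
    rintro _ ⟨x, -, rfl⟩
    exact hlL x
  obtain ⟨y, hyM, hyL⟩ : ∃ y ∈ M, y ∉ L :=
    Set.not_subset.1 fun h : M ≤ L => hL (by rw [← hLM, sup_eq_left.2 h])
  have hco : IsCoatom (Subgroup.closure (l '' s) ⊔ N) :=
    Subgroup.isCoatom_of_covBy_of_sup_eq_top hNM le_sup_right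
      (by rw [sup_assoc, sup_eq_right.2 hNM.le, hq])
      fun h => hL (top_le_iff.1 (h ▸ sup_le hlsL hNL))
  have hfinal : IsMinGenMod N (insert y (l '' s)) := by
    refine ⟨hco.2 _ (lt_of_le_of_ne ?_ fun h => hyL ?_), fun t ht hts => ?_⟩
    · exact sup_le_sup_right (Subgroup.closure_mono (Set.subset_insert _ _)) N
    · have hy : y ∈ Subgroup.closure (insert y (l '' s)) ⊔ N :=
        Subgroup.mem_sup_left (Subgroup.subset_closure (Set.mem_insert _ _))
      rw [← h] at hy
      exact sup_le hlsL hNL hy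
    · have hyt : y ∈ t := by
        by_contra hyt
        have : t ⊆ l '' s := (Set.subset_insert_iff_of_notMem hyt).1 hts
        exact hL (top_le_iff.1 (ht ▸ sup_le ((Subgroup.closure_mono this).trans hlsL) hNL))
      refine Set.insert_subset hyt fun z hz => ?_
      refine (hmin.2 (y := t ∩ l '' s) ?_ Set.inter_subset_right hz).1
      refine top_le_iff.1 (ht ▸ sup_le ((Subgroup.closure_le _).2 fun w hw => ?_)
        (hNM.le.trans le_sup_right))
      rcases hts hw with rfl | hw'
      · exact Subgroup.mem_sup_right hyM
      · exact Subgroup.mem_sup_left (Subgroup.subset_closure ⟨hw, hw'⟩)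
  have hy : y ∉ l '' s := fun h => hyL (hlsL (Subgroup.subset_closure h))
  rw [← hcard, ← hinj.ncard_image, ← Set.ncard_insert_of_notMem hy]
  exact hfinal.ncard_le

lemma mGMod_eq_add_one (hNM : N ⋖ M) (hNL : N ≤ L) (hLM : L ⊔ M = ⊤) (hL : L ≠ ⊤) :
    mGMod N = mGMod M + 1 :=
  (mGMod_le_add_one hNM).antisymm (add_one_le_mGMod hNM hNL hLM hL)

end Step

open scoped commutatorElement

section Complement

variable {G : Type*} [Group G]

lemma Submodule.exists_addMonoidHom_eq_self_of_mem {k A : Type*} [Field k] [AddCommGroup A]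
    [Module k A] (S : Submodule k A) : ∃ g : A →+ A, (∀ x, g x ∈ S) ∧ ∀ x ∈ S, g x = x := by
  obtain ⟨g, hg⟩ := LinearMap.exists_extend (p := S) LinearMap.id
  exact ⟨(S.subtype ∘ₗ g).toAddMonoidHom, fun x => (g x).2,
    fun x hx => congrArg Subtype.val (LinearMap.congr_fun hg ⟨x, hx⟩)⟩

lemma exists_monoidHom_eq_self_of_mem {V : Type*} [CommGroup V] {p : ℕ} (hp : p.Prime)
    (hexp : ∀ x : V, x ^ p = 1) (N : Subgroup V) :
    ∃ f : V →* V, (∀ x, f x ∈ N) ∧ ∀ x ∈ N, f x = x := by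
  have := Fact.mk hp
  let : Module (ZMod p) (Additive V) := AddCommGroup.zmodModule fun x => hexp x.toMul
  obtain ⟨g, hgN, hg⟩ := Submodule.exists_addMonoidHom_eq_self_of_mem
    (AddSubgroup.toZModSubmodule p N.toAddSubgroup)
  exact ⟨AddMonoidHom.toMultiplicative g, fun x => hgN (Additive.ofMul x),
    fun x hx => hg (Additive.ofMul x) hx⟩

/-- A version of Maschke's theorem: a `K`-invariant subgroup of an elementary abelian group
is the image of a `K`-equivariant endomorphism acting on it as a power map. -/
lemma exists_equivariant_monoidHom {V N : Subgroup G} [hV : V.Normal] [hN : N.Normal]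
    (hcomm : ∀ x ∈ V, ∀ y ∈ V, x * y = y * x) {p : ℕ} (hp : p.Prime)
    (hexp : ∀ x ∈ V, x ^ p = 1) (K : Subgroup G) [Finite K] :
    ∃ F : V →* V, (∀ x, (F x : G) ∈ N) ∧ (∀ x : V, (x : G) ∈ N → F x = x ^ Nat.card K) ∧
      ∀ k ∈ K, ∀ x, F (MulAut.conjNormal k x) = MulAut.conjNormal k (F x) := by
  let : CommGroup V :=
    { (inferInstance : Group V) with
      mul_comm := fun x y => Subtype.ext (hcomm x x.2 y y.2) }
  have := Fintype.ofFinite K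
  obtain ⟨f, hfN, hf⟩ := exists_monoidHom_eq_self_of_mem hp
    (fun x : V => Subtype.ext (hexp x x.2)) (N.subgroupOf V)
  let c : K → V →* V := fun k => (MulAut.conjNormal (k : G)).toMonoidHom
  have hc : ∀ k x, c k x = MulAut.conjNormal (k : G) x := fun _ _ => rfl
  have hmul : ∀ k l x, c k (c l x) = c (k * l) x := by
    intro k l x
    simp [hc]
  have hcN : ∀ k x, x ∈ N.subgroupOf V → c k x ∈ N.subgroupOf V := by
    intro k x hx
    exact hN.conj_mem _ hx k
  let F : V →* V := ∏ k : K, (c k).comp (f.comp (c k⁻¹))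
  have hF : ∀ x, F x = ∏ k : K, c k (f (c k⁻¹ x)) := fun x => by
    simp [F]
  refine ⟨F, fun x => ?_, fun x hx => ?_, fun h hh x => ?_⟩
  · have : F x ∈ N.subgroupOf V := by
      rw [hF]
      exact Subgroup.prod_mem _ fun k _ => hcN k _ (hfN _)
    exact this
  · have : ∀ k : K, c k (f (c k⁻¹ x)) = x := fun k => by
      rw [hf _ (hcN _ x hx), hmul, mul_inv_cancel]
      simp [hc]
    rw [hF, Finset.prod_congr rfl fun k _ => this k, Finset.prod_const, Finset.card_univ,
      Nat.card_eq_fintype_card]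
  · change F (c ⟨h, hh⟩ x) = c ⟨h, hh⟩ (F x)
    rw [hF, hF, map_prod]
    symm
    refine Fintype.prod_equiv (Equiv.mulLeft (⟨h, hh⟩ : K)) _ _ fun k => ?_
    simp only [Equiv.coe_mulLeft, hmul, mul_inv_rev, inv_mul_cancel_right]

lemma exists_ne_top_sup_eq_top {V N K : Subgroup G} [hV : V.Normal] [N.Normal] [Finite K]
    (hcomm : ∀ x ∈ V, ∀ y ∈ V, x * y = y * x) {p : ℕ} (hp : p.Prime)
    (hexp : ∀ x ∈ V, x ^ p = 1) (hVK : V ⊔ K = ⊤) (hcop : (Nat.card K).Coprime p)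
    (hNV : N ≤ V) (hN : N ≠ ⊥) : ∃ L : Subgroup G, L ⊔ N = ⊤ ∧ L ≠ ⊤ := by
  obtain ⟨F, hFN, hF, hFK⟩ := exists_equivariant_monoidHom (N := N) hcomm hp hexp K
  have hcop' : ∀ x ∈ V, (Nat.card K).Coprime (orderOf x) := fun x hx =>
    hcop.coprime_dvd_right (orderOf_dvd_of_pow_eq_one (hexp x hx))
  have hconj : ∀ k ∈ K, ∀ w ∈ F.ker.map V.subtype, k * w * k⁻¹ ∈ F.ker.map V.subtype := by
    rintro k hk _ ⟨w, hw, rfl⟩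
    exact ⟨MulAut.conjNormal k w,
      by rw [SetLike.mem_coe, MonoidHom.mem_ker, hFK k hk, MonoidHom.mem_ker.1 hw, map_one], rfl⟩
  have hWV : F.ker.map V.subtype ≤ V := Subgroup.map_subtype_le _
  have hW : (F.ker.map V.subtype).Normal := by
    rw [← Subgroup.normalizer_eq_top_iff, ← top_le_iff, ← hVK, sup_le_iff]
    constructor
    · refine fun v hv => Subgroup.mem_normalizer_iff.2 fun w => ?_
      have key : ∀ u ∈ V, ∀ w ∈ F.ker.map V.subtype, u * w * u⁻¹ = w := fun u hu w hw => by
        rw [hcomm u hu w (hWV hw), mul_inv_cancel_right]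
      refine ⟨fun hw => by rwa [key v hv w hw], fun hw => ?_⟩
      have := key v⁻¹ (V.inv_mem hv) _ hw
      rw [← this] at hw
      simpa [mul_assoc] using hw
    · refine fun k hk => Subgroup.mem_normalizer_iff.2 fun w => ⟨hconj k hk w, fun hw => ?_⟩
      simpa [mul_assoc] using hconj k⁻¹ (K.inv_mem hk) _ hw
  refine ⟨F.ker.map V.subtype ⊔ K, ?_, fun htop => hN ((Subgroup.eq_bot_iff_forall _).2 ?_)⟩
  · rw [← top_le_iff, ← hVK, sup_le_iff]
    refine ⟨fun v hv => ?_, le_sup_right.trans le_sup_left⟩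
    set n := F ⟨v, hv⟩ with hn
    obtain ⟨m, hm⟩ := exists_pow_eq_self_of_coprime (hcop' n n.2)
    have hFn : F (n ^ m) = n := by
      rw [hF _ (by simpa using N.pow_mem (hFN _) m), pow_right_comm]
      exact Subtype.ext (by simpa using hm)
    have hker : v * ((n : G) ^ m)⁻¹ ∈ F.ker.map V.subtype :=
      ⟨⟨v, hv⟩ * (n ^ m)⁻¹, by
        rw [SetLike.mem_coe, MonoidHom.mem_ker, map_mul, map_inv, hFn, ← hn, mul_inv_cancel],
        by simp⟩
    have := Subgroup.mul_mem_sup (Subgroup.mem_sup_left (T := K) hker)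
      (N.pow_mem (hFN ⟨v, hv⟩) m)
    rwa [← hn, inv_mul_cancel_right] at this
  · intro n hn
    obtain ⟨w, hw, k, hk, rfl⟩ : ∃ w ∈ F.ker.map V.subtype, ∃ k ∈ K, w * k = n :=
      Subgroup.mem_sup_of_normal_left.1 (htop ▸ Subgroup.mem_top n)
    have hkV : k ∈ V := (V.mul_mem_cancel_left (hWV hw)).1 (hNV hn)
    have hk1 : k = 1 := orderOf_eq_one_iff.1
      ((hcop' k hkV).symm.eq_one_of_dvd (Subgroup.orderOf_dvd_natCard K hk))
    rw [hk1, mul_one] at hn ⊢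
    obtain ⟨w, hw, rfl⟩ := hw
    obtain ⟨m, hm⟩ := exists_pow_eq_self_of_coprime (hcop' w w.2)
    have : w ^ Nat.card K = 1 := (hF w hn).symm.trans hw
    have hw1 : (w : G) ^ Nat.card K = 1 := congrArg Subtype.val this
    rw [hw1, one_pow] at hm
    exact hm.symm

/-- Relative version of `exists_ne_top_sup_eq_top`, for a section `P / Q` of `G`. -/
lemma exists_le_ne_top_sup_eq_top {P Q N K : Subgroup G} [P.Normal] [Q.Normal] [N.Normal]
    [Finite K] {p : ℕ} (hp : p.Prime) (hcomm : ∀ x ∈ P, ∀ y ∈ P, ⁅x, y⁆ ∈ Q)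
    (hexp : ∀ x ∈ P, x ^ p ∈ Q) (hPK : P ⊔ K = ⊤) (hcop : (Nat.card K).Coprime p)
    (hQN : Q < N) (hNP : N ≤ P) : ∃ L : Subgroup G, Q ≤ L ∧ L ⊔ N = ⊤ ∧ L ≠ ⊤ := by
  let π := QuotientGroup.mk' Q
  have hπ : Function.Surjective π := QuotientGroup.mk'_surjective Q
  have : (P.map π).Normal := Subgroup.Normal.map inferInstance π hπ
  have : (N.map π).Normal := Subgroup.Normal.map inferInstance π hπ
  have : Finite (K.map π) := Set.Finite.image π (Set.toFinite (K : Set G))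
  obtain ⟨L, hLN, hL⟩ : ∃ L : Subgroup (G ⧸ Q), L ⊔ N.map π = ⊤ ∧ L ≠ ⊤ := by
    refine exists_ne_top_sup_eq_top (V := P.map π) (K := K.map π) ?_ hp ?_ ?_
      (hcop.coprime_dvd_left (K.card_map_dvd π)) (Subgroup.map_mono hNP) ?_
    · rintro _ ⟨x, hx, rfl⟩ _ ⟨y, hy, rfl⟩
      rw [← commutatorElement_eq_one_iff_mul_comm, ← map_commutatorElement]
      exact (QuotientGroup.eq_one_iff _).2 (hcomm x hx y hy)
    · rintro _ ⟨x, hx, rfl⟩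
      rw [← map_pow]
      exact (QuotientGroup.eq_one_iff _).2 (hexp x hx)
    · rw [← Subgroup.map_sup, hPK, ← MonoidHom.range_eq_map, MonoidHom.range_eq_top.2 hπ]
    · rw [Ne, Subgroup.map_eq_bot_iff, QuotientGroup.ker_mk']
      exact hQN.not_ge
  refine ⟨L.comap π, ?_, ?_, fun h => hL ?_⟩
  · exact (QuotientGroup.ker_mk' Q).symm.le.trans (MonoidHom.ker_le_comap π L)
  · have := congrArg (Subgroup.comap π) hLN
    rw [← Subgroup.comap_sup_eq π _ _ hπ, Subgroup.comap_map_eq, QuotientGroup.ker_mk',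
      sup_eq_left.2 hQN.le, Subgroup.comap_top] at this
    exact this
  · exact Subgroup.comap_injective hπ (h.trans (Subgroup.comap_top π).symm)

end Complement

section Frattini

variable {P : Type*} [Group P]

lemma IsCoatom.zpowers_eq_top {M : Subgroup P} [M.Normal] (hM : IsCoatom M)
    {x : P ⧸ M} (hx : x ≠ 1) : Subgroup.zpowers x = ⊤ := by
  have hπ := QuotientGroup.mk'_surjective M
  apply Subgroup.comap_injective hπ
  rw [Subgroup.comap_top]
  apply hM.2
  refine lt_of_le_of_ne
    ((QuotientGroup.ker_mk' M).symm.le.trans (MonoidHom.ker_le_comap _ _)) fun h => hx ?_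
  obtain ⟨y, rfl⟩ := hπ x
  have hy : y ∈ M := h ▸ Subgroup.mem_comap.2 (Subgroup.mem_zpowers _)
  exact (QuotientGroup.eq_one_iff y).2 hy

lemma IsPGroup.commutator_and_pow_mem_frattini [Finite P] {p : ℕ} (hp : p.Prime)
    (hP : IsPGroup p P) :
    (∀ x y : P, ⁅x, y⁆ ∈ frattini P) ∧ ∀ x : P, x ^ p ∈ frattini P := by
  have := Fact.mk hp
  have := hP.isNilpotent
  have hmem : ∀ z : P, (∀ M : Subgroup P, IsCoatom M → z ∈ M) → z ∈ frattini P := fun z hz => by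
    simpa [frattini, Order.radical, Subgroup.mem_iInf] using hz
  constructor
  · refine fun x y => hmem _ fun M hM => ?_
    have := Subgroup.NormalizerCondition.normal_of_coatom M
      Group.normalizerCondition_of_isNilpotent hM
    rw [← QuotientGroup.eq_one_iff]
    change QuotientGroup.mk' M ⁅x, y⁆ = 1
    rw [map_commutatorElement, commutatorElement_eq_one_iff_mul_comm]
    by_cases hx : QuotientGroup.mk' M x = 1
    · rw [hx, one_mul, mul_one]
    · obtain ⟨k, hk⟩ := Subgroup.mem_zpowers_iff.1
        ((hM.zpowers_eq_top hx).symm ▸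
          Subgroup.mem_top (QuotientGroup.mk' M y))
      rw [← hk]
      exact (Commute.refl _).zpow_right k
  · refine fun x => hmem _ fun M hM => ?_
    have := Subgroup.NormalizerCondition.normal_of_coatom M
      Group.normalizerCondition_of_isNilpotent hM
    rw [← QuotientGroup.eq_one_iff, QuotientGroup.mk_pow]
    by_contra hne
    have hx : (x : P ⧸ M) ≠ 1 := fun h => hne (by rw [h, one_pow])
    have hcard : orderOf ((x : P ⧸ M) ^ p) = orderOf (x : P ⧸ M) := by
      rw [← Nat.card_zpowers, ← Nat.card_zpowers, hM.zpowers_eq_top hne,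
        hM.zpowers_eq_top hx]
    have hdvd : p ∣ orderOf (x : P ⧸ M) := by
      obtain ⟨k, hk⟩ := IsPGroup.iff_orderOf.1 (hP.to_quotient M) (x : P ⧸ M)
      rw [hk]
      refine dvd_pow_self p fun h0 => hx ?_
      rwa [h0, pow_zero, orderOf_eq_one_iff] at hk
    rw [orderOf_pow_of_dvd hp.ne_zero hdvd] at hcard
    exact (Nat.div_lt_self (orderOf_pos _) hp.one_lt).ne hcard

end Frattini

lemma Subgroup.eq_top_of_sup_map_frattini_eq_top {G : Type*} [Group G] [Finite G] {P H : Subgroup G}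
    [P.Normal] (h : H ⊔ (frattini P).map P.subtype = ⊤) : H = ⊤ := by
  have hΦ : (frattini P).map P.subtype ≤ P := Subgroup.map_subtype_le _
  have hPH : P ≤ H := by
    rw [← Subgroup.subgroupOf_eq_top]
    apply frattini_nongenerating
    refine top_le_iff.1 fun x _ => ?_
    obtain ⟨y, hy, _, ⟨z, hz, rfl⟩, hyz⟩ :
        ∃ y ∈ H, ∃ z ∈ (frattini P).map P.subtype, y * z = x :=
      Subgroup.mem_sup_of_normal_right.1 (h ▸ Subgroup.mem_top _)
    have hyP : y ∈ P := (P.mul_mem_cancel_right z.2).1 (hyz.symm ▸ x.2)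
    have : x = ⟨y, hyP⟩ * z := Subtype.ext hyz.symm
    rw [this]
    exact Subgroup.mul_mem_sup hy hz
  rw [← h, sup_eq_left.2 (hΦ.trans hPH)]

section Supersolvable

variable {G : Type*} [Group G]

lemma Subgroup.covBy_of_relIndex_dvd_prime {Q N : Subgroup G} {p : ℕ} (hp : p.Prime) (h : Q < N)
    (hdvd : Q.relIndex N ∣ p) : Q ⋖ N := by
  refine ⟨h, fun A hQA hAN => ?_⟩
  rw [← Subgroup.relIndex_mul_relIndex Q A N hQA.le hAN.le] at hdvd
  have h1 : Q.relIndex A ≠ 1 := fun h => hQA.not_ge (Subgroup.relIndex_eq_one.1 h)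
  have h2 : A.relIndex N ≠ 1 := fun h => hAN.not_ge (Subgroup.relIndex_eq_one.1 h)
  have h3 := (hp.eq_one_or_self_of_dvd _ ((dvd_mul_right _ _).trans hdvd)).resolve_left h1
  have h4 := (hp.eq_one_or_self_of_dvd _ ((dvd_mul_left _ _).trans hdvd)).resolve_left h2
  rw [h3, h4] at hdvd
  have := Nat.le_of_dvd hp.pos hdvd
  nlinarith [hp.one_lt]

lemma Supersolvable.exists_normal_covBy (hG : Supersolvable G) {P Q : Subgroup G} [P.Normal]
    [hQ : Q.Normal] {p : ℕ} (hp : p.Prime) (hexp : ∀ x ∈ P, x ^ p ∈ Q) (hQP : Q < P) :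
    ∃ N : Subgroup G, N.Normal ∧ Q ⋖ N ∧ N ≤ P := by
  obtain ⟨n, H, hH, h0, hlast, hmono, hcyc⟩ := hG
  obtain ⟨i, hi, hi'⟩ : ∃ i : Fin n, H i.castSucc ⊓ P ≤ Q ∧ ¬ H i.succ ⊓ P ≤ Q := by
    by_contra! hall
    have : ∀ i, H i ⊓ P ≤ Q := fun i =>
      Fin.induction (by rw [h0, bot_inf_eq]; exact bot_le) hall i
    have := this (Fin.last n)
    rw [hlast, top_inf_eq] at this
    exact hQP.not_ge this
  have := hH i.succ
  have := hH i.castSucc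
  set R := H i.succ ⊓ P with hR
  have : R.Normal := Subgroup.normal_inf_normal _ _
  refine ⟨R ⊔ Q, inferInstance, Subgroup.covBy_of_relIndex_dvd_prime hp ?_ ?_,
    sup_le inf_le_right hQP.le⟩
  · exact lt_of_le_of_ne le_sup_right fun h => hi' (h ▸ le_sup_left)
  · have hQR : (Q.subgroupOf R).Normal := hQ.subgroupOf R
    have hHR : ((H i.castSucc).subgroupOf R).Normal := (hH _).subgroupOf R
    have hHH : ((H i.castSucc).subgroupOf (H i.succ)).Normal := (hH _).subgroupOf _
    have : IsCyclic (H i.succ ⧸ (H i.castSucc).subgroupOf (H i.succ)) := hcyc i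
    let f : R ⧸ (H i.castSucc).subgroupOf R →* H i.succ ⧸ (H i.castSucc).subgroupOf (H i.succ) :=
      QuotientGroup.quotientMapSubgroupOfOfLe le_rfl inf_le_left
    have hf : Function.Injective f := by
      rw [injective_iff_map_eq_one]
      intro a
      refine QuotientGroup.induction_on a fun x hx => ?_
      have hx' := (QuotientGroup.eq_one_iff _).1 hx
      exact (QuotientGroup.eq_one_iff _).2 hx'
    have := isCyclic_of_injective f hf
    have hle : (H i.castSucc).subgroupOf R ≤ (Q.subgroupOf R).comap (MonoidHom.id R) :=
      fun x hx => hi ⟨hx, x.2.2⟩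
    let g := QuotientGroup.map _ (Q.subgroupOf R) (MonoidHom.id R) hle
    have : IsCyclic (R ⧸ Q.subgroupOf R) := isCyclic_of_surjective g
      (QuotientGroup.map_surjective_of_surjective _ _ _
        (Function.Surjective.comp (QuotientGroup.mk'_surjective _) Function.surjective_id) hle)
    rw [Subgroup.relIndex_sup_right, Subgroup.relIndex, Subgroup.index, ← IsCyclic.exponent_eq_card]
    refine Monoid.exponent_dvd_of_forall_pow_eq_one fun a => ?_
    refine QuotientGroup.induction_on a fun x => ?_
    exact (QuotientGroup.eq_one_iff (x ^ p)).2 (hexp x x.2.2)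

lemma CovBy.subgroupOf {P Q N : Subgroup G} (h : Q ⋖ N) (hNP : N ≤ P) :
    Q.subgroupOf P ⋖ N.subgroupOf P := by
  have hlt : ∀ {A B : Subgroup P}, A < B ↔ A.map P.subtype < B.map P.subtype :=
    (Subgroup.map_lt_map_iff_of_injective P.subtype_injective).symm
  have hQ := Subgroup.map_subgroupOf_eq_of_le (h.le.trans hNP)
  have hN := Subgroup.map_subgroupOf_eq_of_le hNP
  refine ⟨hlt.2 (by rw [hQ, hN]; exact h.lt), fun A h1 h2 => ?_⟩
  rw [hlt, hQ] at h1
  rw [hlt, hN] at h2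
  exact h.2 h1 h2

lemma mGMod_subgroupOf_eq_add_one [Finite G] {P Q N L : Subgroup G} [N.Normal] (hQN : Q ⋖ N)
    (hNP : N ≤ P) (hQL : Q ≤ L) (hLN : L ⊔ N = ⊤) (hL : L ≠ ⊤) :
    mGMod (Q.subgroupOf P) = mGMod (N.subgroupOf P) + 1 := by
  refine mGMod_eq_add_one (hQN.subgroupOf hNP) (L := L.subgroupOf P)
    (Subgroup.subgroupOf_mono P hQL) ?_ fun h => hL ?_
  · refine top_le_iff.1 fun x _ => ?_
    obtain ⟨y, hy, z, hz, hyz⟩ : ∃ y ∈ L, ∃ z ∈ N, y * z = x :=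
      Subgroup.mem_sup_of_normal_right.1 (hLN ▸ Subgroup.mem_top _)
    have hyP : y ∈ P := (P.mul_mem_cancel_right (hNP hz)).1 (hyz.symm ▸ x.2)
    have : x = ⟨y, hyP⟩ * ⟨z, hNP hz⟩ := Subtype.ext hyz.symm
    rw [this]
    exact Subgroup.mul_mem_sup hy hz
  · rw [← hLN, sup_eq_left.2 (hNP.trans (Subgroup.subgroupOf_eq_top.1 h))]

lemma Supersolvable.mGMod_eq_add [Finite G] (hG : Supersolvable G) {P K : Subgroup G} [P.Normal]
    {p : ℕ} (hp : p.Prime) (hPK : P ⊔ K = ⊤) (hcop : (Nat.card K).Coprime p) (Q : Subgroup G)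
    [hQ : Q.Normal] (hQP : Q ≤ P) (hcomm : ∀ x ∈ P, ∀ y ∈ P, ⁅x, y⁆ ∈ Q)
    (hexp : ∀ x ∈ P, x ^ p ∈ Q) :
    mGMod Q = mGMod (Q.subgroupOf P) + mGMod P := by
  revert hQ
  induction Q using WellFoundedGT.induction with
  | ind Q ih =>
    intro hQ
    rcases hQP.eq_or_lt with rfl | hlt
    · rw [Subgroup.subgroupOf_self, mGMod_top, zero_add]
    obtain ⟨N, hN, hQN, hNP⟩ := hG.exists_normal_covBy hp hexp hlt
    obtain ⟨L, hQL, hLN, hL⟩ := exists_le_ne_top_sup_eq_top hp hcomm hexp hPK hcop hQN.lt hNP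
    rw [mGMod_eq_add_one hQN hQL hLN hL, mGMod_subgroupOf_eq_add_one hQN hNP hQL hLN hL,
      ih N hQN.lt hNP (fun x hx y hy => hQN.le (hcomm x hx y hy))
        (fun x hx => hQN.le (hexp x hx)),
      add_right_comm]

end Supersolvable

/-- Let `G` be a finite supersolvable group, `p` the largest prime dividing
`|G|`, `P` the normal Sylow `p`-subgroup and `K` a complement to `P`, so that
`G = P ⋊ K`.  Then `m(G) = m(P) + m(K)`. -/
theorem mG_eq_mG_add_mG
    {G : Type*} [Group G] [Finite G] (hG : Supersolvable G)
    {p : ℕ} (hp : p.Prime) (hdvd : p ∣ Nat.card G)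
    (hmax : ∀ q : ℕ, q.Prime → q ∣ Nat.card G → q ≤ p)
    (P K : Subgroup G) (hPnormal : P.Normal)
    (hSylow : Nat.card P = p ^ (Nat.card G).factorization p)
    (hcompl : Subgroup.IsComplement' P K) :
    mG G = mG P + mG K := by
  have hcardP : Nat.card P * Nat.card K = Nat.card G := hcompl.card_mul_card
  have hcop : (Nat.card K).Coprime p := by
    refine ((Nat.Prime.coprime_iff_not_dvd hp).2 fun hpK => ?_).symm
    refine Nat.pow_succ_factorization_not_dvd (Nat.card_pos (α := G)).ne' hp ?_
    rw [pow_succ, ← hSylow]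
    exact (Nat.mul_dvd_mul_left _ hpK).trans hcardP.dvd
  have hPp : IsPGroup p P := IsPGroup.of_card hSylow
  obtain ⟨hcomm, hexp⟩ := hPp.commutator_and_pow_mem_frattini hp
  have hΦ : (frattini P).map P.subtype ≤ P := Subgroup.map_subtype_le _
  have key := hG.mGMod_eq_add hp hcompl.sup_eq_top hcop ((frattini P).map P.subtype) hΦ
    (fun x hx y hy => ⟨_, hcomm ⟨x, hx⟩ ⟨y, hy⟩, rfl⟩)
    (fun x hx => ⟨_, hexp ⟨x, hx⟩, rfl⟩)
  have hsub : ((frattini P).map P.subtype).subgroupOf P = frattini P :=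
    Subgroup.comap_map_eq_self_of_injective P.subtype_injective _
  rw [hsub, mGMod_eq_mG_of_nongenerating fun _ => Subgroup.eq_top_of_sup_map_frattini_eq_top,
    mGMod_eq_mG_of_nongenerating fun _ => frattini_nongenerating,
    mGMod_eq_mG_of_isComplement' hcompl] at key
  exact key
end
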